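/- If a bipartite graph G with left degree D has ((2/3)D + 2)-expansion up to K+1, then G has dynamic matching up to K (with load 1). -/

import Mathlib

/-!
Bipartite graphs are modelled by a neighborhood function `Nbr : L → Finset R`
on finite types `L` (left nodes) and `R` (right nodes).

The dynamic matching game with parameters `K` and `ℓ` (the load):
Requester and Matcher maintain a set `M` of edges, initially empty, and alternate
turns with Requester first.  At round `n`, Requester removes a set of edges from `M`
(so that afterwards `#M ≤ K - 1`) and selects a left node; Matcher replies, according
to her strategy, by adding one edge of the graph incident on the selected node,
and afterwards every right node must be incident on at most `ℓ` edges of `M`.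
A strategy is winning if against every legal play of Requester all these
conditions always hold.
-/

namespace DM

/-- A Requester move: a set of edges to remove from the matching, and the requested left node. -/
abbrev ReqMove (α β : Type) := Finset (α × β) × α

/-- A Matcher strategy: maps each finite history of Requester moves to the set of
edges Matcher adds (a valid reply adds exactly one edge incident on the request). -/
abbrev Strategy (α β : Type) := List (ReqMove α β) → Finset (α × β)

/-- A Requester move in the ε-rich game: a set of left nodes whose requests are retracted
(all their matched edges are removed together), and the requested left node. -/
abbrev RReqMove (α : Type) := Finset α × α

/-- A Matcher strategy in the ε-rich game: maps each finite history of Requester moves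
to the set of edges Matcher adds. -/
abbrev RStrategy (α β : Type) := List (RReqMove α) → Finset (α × β)

variable {L R R₁ R₂ : Type} [DecidableEq L] [DecidableEq R] [DecidableEq R₁] [DecidableEq R₂]

/-- The set of neighbors of a set `S` of left nodes. -/
def NbrSet (Nbr : L → Finset R) (S : Finset L) : Finset R := S.biUnion Nbr

/-- The graph has `e`-expansion up to `K`: every left set `S` with `#S ≤ K`
has at least `e · #S` neighbors. -/
def Expansion (Nbr : L → Finset R) (e : ℚ) (K : ℕ) : Prop :=
  ∀ S : Finset L, S.card ≤ K → e * (S.card : ℚ) ≤ ((NbrSet Nbr S).card : ℚ)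

/-- The `ℓ`-clone of a graph: `ℓ` copies of the right set, with `x` adjacent to `(y, i)`
iff `x` is adjacent to `y` in the original graph. -/
def clone (ℓ : ℕ) (Nbr : L → Finset R) : L → Finset (R × Fin ℓ) :=
  fun x => (Nbr x) ×ˢ (Finset.univ : Finset (Fin ℓ))

/-- The product of two graphs with the same left set: `x` is adjacent to `(y₁, y₂)` iff
`x` is adjacent to `y₁` in the first graph and to `y₂` in the second graph. -/
def prodGraph (Nbr₁ : L → Finset R₁) (Nbr₂ : L → Finset R₂) : L → Finset (R₁ × R₂) :=
  fun x => (Nbr₁ x) ×ˢ (Nbr₂ x)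

/-- The private neighbors of a left set `S`: right nodes with exactly one neighbor in `S`. -/
def privNbrs [Fintype R] (Nbr : L → Finset R) (S : Finset L) : Finset R :=
  Finset.univ.filter fun y => (S.filter fun x => y ∈ Nbr x).card = 1

/-- The history of Requester moves after round `n` (i.e. the moves of rounds `0, …, n`). -/
def histUpTo (req : ℕ → ReqMove L R) (n : ℕ) : List (ReqMove L R) :=
  List.ofFn fun i : Fin (n + 1) => req i.1

/-- The matching `M` after round `n` of play: at round `n`, Requester removes the edges
`(req n).1` and requests `(req n).2`, then Matcher adds the edge(s) given by her strategy. -/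
def matchingAfter (σ : Strategy L R) (req : ℕ → ReqMove L R) : ℕ → Finset (L × R)
  | 0 => ∅
  | n + 1 => σ (histUpTo req n) ∪ (matchingAfter σ req n \ (req n).1)

/-- Requester's move at round `n` is legal: after his removal, `#M ≤ K - 1`. -/
def RemLegal (σ : Strategy L R) (K : ℕ) (req : ℕ → ReqMove L R) (n : ℕ) : Prop :=
  (matchingAfter σ req n \ (req n).1).card < K

/-- Matcher's reply at round `n` is valid for load `ℓ`: she adds exactly one edge of the
graph, incident on the requested node, and afterwards every right node is incident on
at most `ℓ` edges of `M`. -/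
def ValidReply (Nbr : L → Finset R) (ℓ : ℕ) (σ : Strategy L R)
    (req : ℕ → ReqMove L R) (n : ℕ) : Prop :=
  (∃ y ∈ Nbr (req n).2, σ (histUpTo req n) = {((req n).2, y)}) ∧
  ∀ y : R, ((matchingAfter σ req (n + 1)).filter fun p => p.2 = y).card ≤ ℓ

/-- The graph has dynamic matching up to `K` with load `ℓ`: Matcher has a strategy that
replies validly to every legal play of Requester. -/
def DynamicMatching (Nbr : L → Finset R) (K ℓ : ℕ) : Prop :=
  ∃ σ : Strategy L R, ∀ req : ℕ → ReqMove L R, ∀ n : ℕ,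
    (∀ i ≤ n, RemLegal σ K req i) → ValidReply Nbr ℓ σ req n

/-- Incremental matching up to `K` with load `ℓ`: Requester never removes edges,
and the game lasts at most `K` rounds. -/
def IncrementalMatching (Nbr : L → Finset R) (K ℓ : ℕ) : Prop :=
  ∃ σ : Strategy L R, ∀ req : ℕ → ReqMove L R, (∀ i, (req i).1 = ∅) →
    ∀ n < K, ValidReply Nbr ℓ σ req n

/-- Matching with `T` rounds up to `K` with load `ℓ`: the dynamic matching game is
terminated after `T` rounds. -/
def RoundMatching (Nbr : L → Finset R) (T K ℓ : ℕ) : Prop :=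
  ∃ σ : Strategy L R, ∀ req : ℕ → ReqMove L R, ∀ n < T,
    (∀ i ≤ n, RemLegal σ K req i) → ValidReply Nbr ℓ σ req n

/-- The edge Matcher added at round `i` is removed by Requester during one of the
rounds `i + 1, …, i + T`. -/
def ExpiredAt (σ : Strategy L R) (T : ℕ) (req : ℕ → ReqMove L R) (i : ℕ) : Prop :=
  ∃ j, i < j ∧ j ≤ i + T ∧ ∀ e ∈ σ (histUpTo req i), e ∈ (req j).1

/-- Matching up to `K` with `T`-expiration and load `ℓ`: the dynamic matching game in
which Requester must remove the edge added at round `i` during one of the rounds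
`i + 1, …, i + T`. -/
def ExpiringMatching (Nbr : L → Finset R) (T K ℓ : ℕ) : Prop :=
  ∃ σ : Strategy L R, ∀ req : ℕ → ReqMove L R, ∀ n : ℕ,
    (∀ i ≤ n, RemLegal σ K req i) → (∀ i, i + T ≤ n → ExpiredAt σ T req i) →
    ValidReply Nbr ℓ σ req n

/-! ### The ε-rich matching game

In the ε-rich game on a graph with left degree `D`, when Requester requests a left node
`x`, Matcher adds to `M` in one round a set of at least `(1 - ε) · D` edges incident on
`x`; when Requester retracts a request, all its edges are removed together. -/

/-- The history of rich-game Requester moves after round `n`. -/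
def rhistUpTo (req : ℕ → RReqMove L) (n : ℕ) : List (RReqMove L) :=
  List.ofFn fun i : Fin (n + 1) => req i.1

/-- The matching `M` after round `n` of the rich game: at round `n`, Requester retracts
the requests of the left nodes in `(req n).1` (removing all their edges) and requests
`(req n).2`, then Matcher adds the set of edges given by her strategy. -/
def rmatchingAfter (σ : RStrategy L R) (req : ℕ → RReqMove L) : ℕ → Finset (L × R)
  | 0 => ∅
  | n + 1 => σ (rhistUpTo req n) ∪
      ((rmatchingAfter σ req n).filter fun p => p.1 ∉ (req n).1)

/-- Requester's rich-game move at round `n` is legal: after the retraction, at most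
`K - 1` requests remain matched. -/
def RRemLegal (σ : RStrategy L R) (K : ℕ) (req : ℕ → RReqMove L) (n : ℕ) : Prop :=
  ((((rmatchingAfter σ req n).filter fun p => p.1 ∉ (req n).1)).image Prod.fst).card < K

/-- Matcher's rich reply at round `n` is valid for richness `ε` (relative to left degree
`D`) and load `ℓ`: she adds at least `(1 - ε) · D` edges of the graph, all incident on
the requested node, and afterwards every right node is incident on at most `ℓ` edges. -/
def RValidReply (Nbr : L → Finset R) (D : ℕ) (ε : ℚ) (ℓ : ℕ) (σ : RStrategy L R)
    (req : ℕ → RReqMove L) (n : ℕ) : Prop :=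
  (∀ e ∈ σ (rhistUpTo req n), e.1 = (req n).2 ∧ e.2 ∈ Nbr e.1) ∧
  (1 - ε) * (D : ℚ) ≤ ((σ (rhistUpTo req n)).card : ℚ) ∧
  ∀ y : R, ((rmatchingAfter σ req (n + 1)).filter fun p => p.2 = y).card ≤ ℓ

/-- ε-rich matching up to `K` with load `ℓ` (richness relative to left degree `D`). -/
def RichMatching (Nbr : L → Finset R) (D : ℕ) (ε : ℚ) (K ℓ : ℕ) : Prop :=
  ∃ σ : RStrategy L R, ∀ req : ℕ → RReqMove L, ∀ n : ℕ,
    (∀ i ≤ n, RRemLegal σ K req i) → RValidReply Nbr D ε ℓ σ req n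

/-- Incremental ε-rich matching up to `K` with load `ℓ`: Requester never retracts,
and the game lasts at most `K` rounds. -/
def RichIncrementalMatching (Nbr : L → Finset R) (D : ℕ) (ε : ℚ) (K ℓ : ℕ) : Prop :=
  ∃ σ : RStrategy L R, ∀ req : ℕ → RReqMove L, (∀ i, (req i).1 = ∅) →
    ∀ n < K, RValidReply Nbr D ε ℓ σ req n

/-- ε-rich matching up to `K` with `T`-expiration and load `ℓ`: Requester must retract
the request made at round `i` during one of the rounds `i + 1, …, i + T`. -/
def RichExpiringMatching (Nbr : L → Finset R) (D : ℕ) (ε : ℚ) (T K ℓ : ℕ) : Prop :=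
  ∃ σ : RStrategy L R, ∀ req : ℕ → RReqMove L, ∀ n : ℕ,
    (∀ i ≤ n, RRemLegal σ K req i) →
    (∀ i, i + T ≤ n → ∃ j, i < j ∧ j ≤ i + T ∧ (req i).2 ∈ (req j).1) →
    RValidReply Nbr D ε ℓ σ req n

end DM

namespace DM

section Criticality

variable {L R : Type} [DecidableEq L] [DecidableEq R]

/-- If `A`-free neighborhoods satisfy Hall's condition up to size `K` on sets of nodes satisfying
`P`, and tight sets have size less than `K / 2`, then right nodes that are each covered by a tight
set are covered by a single tight set. -/
lemma exists_tight_cover (Nbr : L → Finset R) (A : Finset R) (P : L → Prop) (K : ℕ)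
    (hall : ∀ S : Finset L, S.card ≤ K → (∀ x ∈ S, P x) → S.card ≤ (NbrSet Nbr S \ A).card)
    (small : ∀ S : Finset L, S.card ≤ K → (NbrSet Nbr S \ A).card ≤ S.card → 2 * S.card < K)
    (hK : 0 < K) (T : Finset R)
    (hT : ∀ y ∈ T, ∃ S : Finset L, S.card ≤ K ∧ (∀ x ∈ S, P x) ∧
      (NbrSet Nbr S \ A).card ≤ S.card ∧ y ∈ NbrSet Nbr S) :
    ∃ U : Finset L, 2 * U.card < K ∧ (∀ x ∈ U, P x) ∧
      (NbrSet Nbr U \ A).card ≤ U.card ∧ T ⊆ NbrSet Nbr U := by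
  induction T using Finset.induction_on with
  | empty => exact ⟨∅, by simpa using hK, by simp, by simp [NbrSet], by simp⟩
  | insert y T _ ih =>
    obtain ⟨U, hUK, hUP, hUt, hTU⟩ := ih fun z hz => hT z (Finset.mem_insert_of_mem hz)
    obtain ⟨S, hSK, hSP, hSt, hyS⟩ := hT y (Finset.mem_insert_self y T)
    have hS2 := small S hSK hSt
    have hcard := Finset.card_union_add_card_inter S U
    have hP : ∀ x ∈ S ∪ U, P x := fun x hx =>
      (Finset.mem_union.1 hx).elim (hSP x) (hUP x)
    have hinter := hall (S ∩ U) (by omega) fun x hx => hSP x (Finset.mem_inter.1 hx).1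
    have hunion : NbrSet Nbr (S ∪ U) \ A = (NbrSet Nbr S \ A) ∪ (NbrSet Nbr U \ A) := by
      simp only [NbrSet, Finset.union_biUnion, Finset.union_sdiff_distrib]
    have hsub : NbrSet Nbr (S ∩ U) \ A ⊆ (NbrSet Nbr S \ A) ∩ (NbrSet Nbr U \ A) := by
      intro z
      simp only [NbrSet, Finset.mem_sdiff, Finset.mem_inter, Finset.mem_biUnion]
      rintro ⟨⟨w, ⟨hwS, hwU⟩, hz⟩, hzA⟩
      exact ⟨⟨⟨w, hwS, hz⟩, hzA⟩, ⟨⟨w, hwU, hz⟩, hzA⟩⟩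
    have hsubcard := Finset.card_le_card hsub
    have hcardN := Finset.card_union_add_card_inter (NbrSet Nbr S \ A) (NbrSet Nbr U \ A)
    have htight : (NbrSet Nbr (S ∪ U) \ A).card ≤ (S ∪ U).card := by
      rw [hunion]; omega
    refine ⟨S ∪ U, small _ (by omega) htight, hP, htight, ?_⟩
    have hN : NbrSet Nbr (S ∪ U) = NbrSet Nbr S ∪ NbrSet Nbr U := by
      simp only [NbrSet, Finset.union_biUnion]
    rw [hN]
    exact Finset.insert_subset (Finset.mem_union_left _ hyS)
      (hTU.trans Finset.subset_union_right)

/-- `M` is a matching in the graph such that the sets of at most `K` unmatched left nodes satisfy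
Hall's condition with respect to the free right nodes. -/
structure ExtendableMatching (Nbr : L → Finset R) (K : ℕ) (M : Finset (L × R)) : Prop where
  edge : ∀ p ∈ M, p.2 ∈ Nbr p.1
  left_inj : ∀ p ∈ M, ∀ q ∈ M, p.1 = q.1 → p = q
  right_inj : ∀ p ∈ M, ∀ q ∈ M, p.2 = q.2 → p = q
  hall : ∀ S : Finset L, S.card ≤ K → (∀ x ∈ S, x ∉ M.image Prod.fst) →
    S.card ≤ (NbrSet Nbr S \ M.image Prod.snd).card

lemma ExtendableMatching.mono {Nbr : L → Finset R} {K : ℕ} {M M' : Finset (L × R)}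
    (h : ExtendableMatching Nbr K M) (hM : M' ⊆ M) : ExtendableMatching Nbr K M' where
  edge p hp := h.edge p (hM hp)
  left_inj p hp q hq := h.left_inj p (hM hp) q (hM hq)
  right_inj p hp q hq := h.right_inj p (hM hp) q (hM hq)
  hall S hSK hS := by
    set S₁ := S.filter fun x => x ∉ M.image Prod.fst with hS₁
    set E := M.filter fun p => p.1 ∈ S with hE
    have hcardE : (E.image Prod.snd).card = E.card :=
      Finset.card_image_of_injOn fun p hp q hq =>
        h.right_inj p (Finset.mem_filter.1 hp).1 q (Finset.mem_filter.1 hq).1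
    have hfree := h.hall S₁ ((Finset.card_filter_le _ _).trans hSK)
      fun x hx => (Finset.mem_filter.1 hx).2
    have hcover : S ⊆ S₁ ∪ E.image Prod.fst := by
      intro x hx
      by_cases hxM : x ∈ M.image Prod.fst
      · obtain ⟨p, hp, rfl⟩ := Finset.mem_image.1 hxM
        exact Finset.mem_union_right _
          (Finset.mem_image_of_mem _ (Finset.mem_filter.2 ⟨hp, hx⟩))
      · exact Finset.mem_union_left _ (Finset.mem_filter.2 ⟨hx, hxM⟩)
    have hSle : S.card ≤ S₁.card + E.card :=
      ((Finset.card_le_card hcover).trans (Finset.card_union_le _ _)).trans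
        (Nat.add_le_add_left Finset.card_image_le _)
    have hdisj : Disjoint (NbrSet Nbr S₁ \ M.image Prod.snd) (E.image Prod.snd) :=
      Finset.disjoint_of_subset_right (Finset.image_subset_image (Finset.filter_subset _ _))
        Finset.sdiff_disjoint
    have hsub : (NbrSet Nbr S₁ \ M.image Prod.snd) ∪ E.image Prod.snd ⊆
        NbrSet Nbr S \ M'.image Prod.snd := by
      refine Finset.union_subset (Finset.sdiff_subset_sdiff
        (Finset.biUnion_subset_biUnion_of_subset_left _ (Finset.filter_subset _ _))
        (Finset.image_subset_image hM)) fun y hy => ?_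
      obtain ⟨p, hp, rfl⟩ := Finset.mem_image.1 hy
      obtain ⟨hpM, hpS⟩ := Finset.mem_filter.1 hp
      refine Finset.mem_sdiff.2 ⟨Finset.mem_biUnion.2 ⟨p.1, hpS, h.edge p hpM⟩, fun hy' => ?_⟩
      obtain ⟨q, hq, hqp⟩ := Finset.mem_image.1 hy'
      obtain rfl := h.right_inj q (hM hq) p hpM hqp
      exact hS _ hpS (Finset.mem_image_of_mem _ hq)
    have hle := Finset.card_le_card hsub
    rw [Finset.card_union_of_disjoint hdisj, hcardE] at hle
    omega

lemma ExtendableMatching.exists_insert {Nbr : L → Finset R} {K : ℕ} {M : Finset (L × R)}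
    (h : ExtendableMatching Nbr K M) (hM : M.card < K)
    (hexp : ∀ S : Finset L, S.card ≤ K → 3 * S.card ≤ (NbrSet Nbr S).card) (x : L) :
    ∃ y ∈ Nbr x, ExtendableMatching Nbr K (insert (x, y) M) := by
  by_cases hx : x ∈ M.image Prod.fst
  · obtain ⟨p, hp, rfl⟩ := Finset.mem_image.1 hx
    exact ⟨p.2, h.edge p hp, by rwa [Finset.insert_eq_of_mem hp]⟩
  by_contra! hno
  set A := M.image Prod.snd with hA
  have hAK : A.card < K := Finset.card_image_le.trans_lt hM
  have small : ∀ S : Finset L, S.card ≤ K → (NbrSet Nbr S \ A).card ≤ S.card →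
      2 * S.card < K := by
    intro S hSK hSt
    have h1 := hexp S hSK
    have h2 := Finset.le_card_sdiff A (NbrSet Nbr S)
    omega
  obtain ⟨U, hUK, hUP, hUt, hTU⟩ := exists_tight_cover Nbr A
    (fun z => z ∉ M.image Prod.fst ∧ z ≠ x) K
    (fun S hS hP => h.hall S hS fun z hz => (hP z hz).1) small (by omega) (Nbr x \ A) (by
      intro y hy
      obtain ⟨hyx, hyA⟩ := Finset.mem_sdiff.1 hy
      by_contra! hcon
      have hnotM : ∀ q ∈ M, q.1 ≠ x ∧ q.2 ≠ y := fun q hq =>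
        ⟨fun e => hx (e ▸ Finset.mem_image_of_mem _ hq),
          fun e => hyA (e ▸ Finset.mem_image_of_mem _ hq)⟩
      refine hno y hyx ⟨?_, ?_, ?_, fun S hSK hS => ?_⟩
      · intro p hp
        rcases Finset.mem_insert.1 hp with rfl | hp
        exacts [hyx, h.edge p hp]
      · intro p hp q hq hpq
        rcases Finset.mem_insert.1 hp with rfl | hp <;>
          rcases Finset.mem_insert.1 hq with rfl | hq
        exacts [rfl, ((hnotM q hq).1 hpq.symm).elim, ((hnotM p hp).1 hpq).elim,
          h.left_inj p hp q hq hpq]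
      · intro p hp q hq hpq
        rcases Finset.mem_insert.1 hp with rfl | hp <;>
          rcases Finset.mem_insert.1 hq with rfl | hq
        exacts [rfl, ((hnotM q hq).2 hpq.symm).elim, ((hnotM p hp).2 hpq).elim,
          h.right_inj p hp q hq hpq]
      · have hSP : ∀ z ∈ S, z ∉ M.image Prod.fst ∧ z ≠ x := fun z hz => by
          have := hS z hz
          rw [Finset.image_insert, Finset.mem_insert, not_or] at this
          exact ⟨this.2, this.1⟩
        have hSle := h.hall S hSK fun z hz => (hSP z hz).1
        rw [Finset.image_insert, Finset.sdiff_insert]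
        change S.card ≤ ((NbrSet Nbr S \ A).erase y).card
        by_cases hyS : y ∈ NbrSet Nbr S
        · have hlt : S.card < (NbrSet Nbr S \ A).card := by
            by_contra! hle
            exact hcon S hSK hSP hle hyS
          have := Finset.pred_card_le_card_erase (s := NbrSet Nbr S \ A) (a := y)
          omega
        · rwa [Finset.erase_eq_of_notMem fun hy' => hyS (Finset.mem_sdiff.1 hy').1])
  have hxU : x ∉ U := fun hxU => (hUP x hxU).2 rfl
  have hcard := Finset.card_insert_of_notMem hxU
  have hle := h.hall (insert x U) (by omega) fun z hz => by
    rcases Finset.mem_insert.1 hz with rfl | hz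
    exacts [hx, (hUP z hz).1]
  have hsub : NbrSet Nbr (insert x U) \ A ⊆ NbrSet Nbr U \ A := by
    intro z hz
    obtain ⟨hz, hzA⟩ := Finset.mem_sdiff.1 hz
    rw [NbrSet, Finset.biUnion_insert, Finset.mem_union] at hz
    refine Finset.mem_sdiff.2 ⟨hz.elim (fun hz => ?_) id, hzA⟩
    exact hTU (Finset.mem_sdiff.2 ⟨hz, hzA⟩)
  have := Finset.card_le_card hsub
  rw [← hA] at hle
  omega

end Criticality

lemma histUpTo_eq_append {L R : Type} (req : ℕ → ReqMove L R) (n : ℕ) :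
    histUpTo req n = (List.ofFn fun i : Fin n => req i.1) ++ [req n] := by
  rw [histUpTo, List.ofFn_succ_last]
  simp

section Positional

variable {L R : Type} [DecidableEq L] [DecidableEq R]

/-- The matching reached from `∅` when Matcher answers the request `x` at a position `M`
by `reply M x`. -/
def positionAfter (reply : Finset (L × R) → L → Finset (L × R)) (h : List (ReqMove L R)) :
    Finset (L × R) :=
  h.foldl (fun M m => reply (M \ m.1) m.2 ∪ (M \ m.1)) ∅

/-- The strategy that answers according to the current position only. -/
def positionalStrategy (reply : Finset (L × R) → L → Finset (L × R)) : Strategy L R :=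
  fun h => h.getLast?.elim ∅ fun m => reply (positionAfter reply h.dropLast \ m.1) m.2

lemma matchingAfter_positionalStrategy (reply : Finset (L × R) → L → Finset (L × R))
    (req : ℕ → ReqMove L R) (n : ℕ) :
    matchingAfter (positionalStrategy reply) req n =
      positionAfter reply (List.ofFn fun i : Fin n => req i.1) := by
  induction n with
  | zero => simp [matchingAfter, positionAfter]
  | succ n ih =>
    change _ = positionAfter reply (histUpTo req n)
    rw [matchingAfter, ih, histUpTo_eq_append]
    simp [positionalStrategy, positionAfter]

lemma positionalStrategy_histUpTo (reply : Finset (L × R) → L → Finset (L × R))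
    (req : ℕ → ReqMove L R) (n : ℕ) :
    positionalStrategy reply (histUpTo req n) =
      reply (matchingAfter (positionalStrategy reply) req n \ (req n).1) (req n).2 := by
  rw [matchingAfter_positionalStrategy, histUpTo_eq_append]
  simp [positionalStrategy]

/-- Matcher wins if she can maintain an invariant that bounds the load. -/
lemma dynamicMatching_of_invariant (Nbr : L → Finset R) (K ℓ : ℕ)
    (Inv : Finset (L × R) → Prop) (empty : Inv ∅)
    (load : ∀ M, Inv M → ∀ y : R, (M.filter fun p => p.2 = y).card ≤ ℓ)
    (extend : ∀ M, Inv M → ∀ E, (M \ E).card < K → ∀ x,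
      ∃ y ∈ Nbr x, Inv (insert (x, y) (M \ E))) :
    DynamicMatching Nbr K ℓ := by
  classical
  let reply : Finset (L × R) → L → Finset (L × R) := fun M x =>
    if h : ∃ y ∈ Nbr x, Inv (insert (x, y) M) then {(x, h.choose)} else ∅
  have hreply : ∀ M x, (∃ y ∈ Nbr x, Inv (insert (x, y) M)) →
      ∃ y ∈ Nbr x, reply M x = {(x, y)} ∧ Inv (insert (x, y) M) := fun M x h =>
    ⟨h.choose, h.choose_spec.1, dif_pos h, h.choose_spec.2⟩
  have step : ∀ req : ℕ → ReqMove L R, ∀ n,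
      Inv (matchingAfter (positionalStrategy reply) req n) →
      RemLegal (positionalStrategy reply) K req n →
      (∃ y ∈ Nbr (req n).2, positionalStrategy reply (histUpTo req n) = {((req n).2, y)}) ∧
      Inv (matchingAfter (positionalStrategy reply) req (n + 1)) := by
    intro req n hInv hleg
    obtain ⟨y, hy, hr, hI⟩ := hreply _ _ (extend _ hInv _ hleg (req n).2)
    rw [← positionalStrategy_histUpTo reply req n] at hr
    refine ⟨⟨y, hy, hr⟩, ?_⟩
    rwa [matchingAfter, hr, ← Finset.insert_eq]
  refine ⟨positionalStrategy reply, fun req n hleg => ?_⟩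
  have hInv : ∀ m ≤ n, Inv (matchingAfter (positionalStrategy reply) req m) := by
    intro m
    induction m with
    | zero => exact fun _ => empty
    | succ m ih => exact fun hm => (step req m (ih (by omega)) (hleg m (by omega))).2
  have hn := step req n (hInv n le_rfl) (hleg n le_rfl)
  exact ⟨hn.1, load _ hn.2⟩

end Positional

/-- Expansion by a factor `3` up to `K` suffices for dynamic matching up to `K`. -/
lemma dynamicMatching_of_three_mul_le {L R : Type} [DecidableEq L] [DecidableEq R]
    (Nbr : L → Finset R) (K : ℕ)
    (hexp : ∀ S : Finset L, S.card ≤ K → 3 * S.card ≤ (NbrSet Nbr S).card) :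
    DynamicMatching Nbr K 1 := by
  refine dynamicMatching_of_invariant Nbr K 1 (ExtendableMatching Nbr K)
    ⟨by simp, by simp, by simp, fun S hS _ => ?_⟩ (fun M hM y => ?_)
    fun M hM E hE x => (hM.mono Finset.sdiff_subset).exists_insert hE hexp x
  · have := hexp S hS
    simp only [Finset.image_empty, Finset.sdiff_empty]
    omega
  · refine Finset.card_le_one.2 fun p hp q hq => ?_
    rw [Finset.mem_filter] at hp hq
    exact hM.right_inj p hp.1 q hq.1 (hp.2.trans hq.2.symm)

end DM

open DM
/-- If a bipartite graph with left degree `D` has `((2/3)·D + 2)`-expansion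
up to `K + 1`, then it has dynamic matching up to `K` with load 1. -/
theorem stmt1 (L R : Type) [Fintype L] [Fintype R] [DecidableEq L] [DecidableEq R]
    (Nbr : L → Finset R) (D K : ℕ)
    (hD : ∀ x : L, (Nbr x).card = D)
    (hexp : Expansion Nbr ((2 / 3 : ℚ) * D + 2) (K + 1)) :
    DynamicMatching Nbr K 1 := by
  refine dynamicMatching_of_three_mul_le Nbr K fun S hS => ?_
  rcases S.eq_empty_or_nonempty with rfl | ⟨x, -⟩
  · simp
  have hD6 : (6 : ℚ) ≤ D := by
    have h := hexp {x} (by simp)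
    simp only [NbrSet, Finset.card_singleton, Finset.singleton_biUnion, hD] at h
    push_cast at h
    linarith
  have h := hexp S (by omega)
  have hS0 : (0 : ℚ) ≤ S.card := by positivity
  have : (3 : ℚ) * S.card ≤ (NbrSet Nbr S).card := by nlinarith
  exact_mod_cast this
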